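/- Let C(z) = Σ_{n≥0} Cat_n z^n. (1) Let A ∈ ℤ[[s,z]] be the power series in which the coefficient of s^k z^n is the number of partitions λ ∈ P^□_n with dsh(λ) = k; then A·((1−s)z + 1 − 2zC(z)) = 1 in ℤ[[s,z]]. (2) Let B ∈ ℤ[[s,z]] be the power series in which the coefficient of s^k z^n is the number of partitions λ with max(λ_1,λ'_1) = n and dsh(λ) = k; then B·((1−s)z + 1 − 2zC(z)) = 1 − z in ℤ[[s,z]]. (These are the power-series forms of A = 1/((1−s)z + √(1−4z)) and B = (1−z)/((1−s)z + √(1−4z)).) -/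

import Mathlib

/-- A partition fitting in the `n × n` square, encoded as its zero-padded part sequence:
an antitone function `f : Fin n → ℕ` with all values at most `n`. -/
def IsBoxPartition (n : ℕ) (f : Fin n → ℕ) : Prop :=
  Antitone f ∧ ∀ i, f i ≤ n

/-- `conjAt n f i = λ'_i = #{j : λ_j ≥ i}` (for `i ≥ 1`), computed inside the box. -/
def conjAt (n : ℕ) (f : Fin n → ℕ) (i : ℕ) : ℕ :=
  (Finset.univ.filter fun j : Fin n => i ≤ f j).card

/-- The number of self-conjugate diagonal hooks of the partition encoded by `f`:
`dsh(λ) = #{i ∈ {1,…,δ(λ)} : λ_i = λ'_i}`, where `i ≤ δ(λ)` iff `λ_i ≥ i`. -/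
def dshPart (n : ℕ) (f : Fin n → ℕ) : ℕ :=
  (Finset.univ.filter fun i : Fin n =>
    i.val + 1 ≤ f i ∧ f i = conjAt n f (i.val + 1)).card

/-- The series `A ∈ ℤ[[s,z]]` whose coefficient of `s^k z^n` is the number of partitions in
`P^□_n` with `dsh(λ) = k`. Variable `0` is `s`, variable `1` is `z`. -/
noncomputable def A : MvPowerSeries (Fin 2) ℤ := fun d =>
  ({f : Fin (d 1) → ℕ | IsBoxPartition (d 1) f ∧ dshPart (d 1) f = d 0}.ncard : ℤ)

/-- The series `B ∈ ℤ[[s,z]]` whose coefficient of `s^k z^n` is the number of partitions with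
`max(λ_1, λ'_1) = n` and `dsh(λ) = k`; here `λ_1 = Finset.univ.sup f` and `λ'_1 = conjAt _ f 1`. -/
noncomputable def B : MvPowerSeries (Fin 2) ℤ := fun d =>
  ({f : Fin (d 1) → ℕ | IsBoxPartition (d 1) f ∧
      max (Finset.univ.sup f) (conjAt (d 1) f 1) = d 1 ∧ dshPart (d 1) f = d 0}.ncard : ℤ)

/-- The Catalan generating function `C(z) = Σ_{n≥0} Cat_n z^n`, viewed in `ℤ[[s,z]]`. -/
noncomputable def Cgf : MvPowerSeries (Fin 2) ℤ := fun d =>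
  if d 0 = 0 then (catalan (d 1) : ℤ) else 0

section

open Finset

/-- Statistic on pairs of finsets. -/
def stt (n : ℕ) (h : ℤ) (R L : Finset ℕ) : ℕ :=
  #{p ∈ range n | p ∈ R ∧ p ∈ L ∧ ((#(R.filter (p < ·)) : ℕ) : ℤ) + h = #(L.filter (p < ·))}

def Wc (n : ℕ) (h : ℤ) (k : ℕ) : ℕ :=
  ∑ R ∈ (range n).powerset, ∑ L ∈ (range n).powerset,
    if ((#R : ℕ) : ℤ) + h = #L ∧ stt n h R L = k then 1 else 0

lemma card_filter_insert_lt {n p : ℕ} {R : Finset ℕ} (hR : R ⊆ range n) (hp : p < n) :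
    #((insert n R).filter (p < ·)) = #(R.filter (p < ·)) + 1 := by
  rw [filter_insert, if_pos hp, card_insert_of_notMem]
  intro h
  have := mem_range.1 (hR (mem_filter.1 h).1)
  omega

lemma filter_insert_self_lt {n : ℕ} {R : Finset ℕ} (hR : R ⊆ range n) :
    (insert n R).filter (n < ·) = ∅ := by
  apply filter_eq_empty_iff.2
  intro x hx
  rcases mem_insert.1 hx with rfl | hx
  · simp
  · have := mem_range.1 (hR hx); omega

lemma stt_00 {n : ℕ} {h : ℤ} {R L : Finset ℕ} (hR : R ⊆ range n) :
    stt (n+1) h R L = stt n h R L := by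
  have hn : n ∉ R := fun h => by simpa using hR h
  unfold stt
  rw [range_add_one, filter_insert, if_neg (by tauto)]

lemma stt_10 {n : ℕ} {h : ℤ} {R L : Finset ℕ} (hR : R ⊆ range n) (hL : L ⊆ range n) :
    stt (n+1) h (insert n R) L = stt n (h+1) R L := by
  have hn : n ∉ L := fun h => by simpa using hL h
  unfold stt
  rw [range_add_one, filter_insert, if_neg (by tauto)]
  congr 1
  apply filter_congr
  intro p hp
  rw [mem_range] at hp
  rw [card_filter_insert_lt hR hp, mem_insert]
  have : p ≠ n := by omega
  simp only [this, false_or]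
  push_cast
  have : ∀ x y : ℤ, x + 1 + h = y ↔ x + (h+1) = y := by intros; omega
  rw [this]

lemma stt_01 {n : ℕ} {h : ℤ} {R L : Finset ℕ} (hR : R ⊆ range n) (hL : L ⊆ range n) :
    stt (n+1) h R (insert n L) = stt n (h-1) R L := by
  have hn : n ∉ R := fun h => by simpa using hR h
  unfold stt
  rw [range_add_one, filter_insert, if_neg (by tauto)]
  congr 1
  apply filter_congr
  intro p hp
  rw [mem_range] at hp
  rw [card_filter_insert_lt hL hp, mem_insert]
  have : p ≠ n := by omega
  simp only [this, false_or]
  push_cast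
  have : ∀ x y : ℤ, x + h = y + 1 ↔ x + (h-1) = y := by intros; omega
  rw [this]

lemma stt_11 {n : ℕ} {h : ℤ} {R L : Finset ℕ} (hR : R ⊆ range n) (hL : L ⊆ range n) :
    stt (n+1) h (insert n R) (insert n L) = stt n h R L + if h = 0 then 1 else 0 := by
  unfold stt
  rw [range_add_one, filter_insert, filter_insert_self_lt hR, filter_insert_self_lt hL]
  have key : {p ∈ range n | p ∈ insert n R ∧ p ∈ insert n L ∧
      ((#((insert n R).filter (p < ·)) : ℕ) : ℤ) + h = #((insert n L).filter (p < ·))} =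
      {p ∈ range n | p ∈ R ∧ p ∈ L ∧
        ((#(R.filter (p < ·)) : ℕ) : ℤ) + h = #(L.filter (p < ·))} := by
    apply filter_congr
    intro p hp
    rw [mem_range] at hp
    rw [card_filter_insert_lt hL hp, card_filter_insert_lt hR hp, mem_insert, mem_insert]
    have : p ≠ n := by omega
    simp only [this, false_or]
    push_cast
    have : ∀ x y : ℤ, x + 1 + h = y + 1 ↔ x + h = y := by intros; omega
    rw [this]
  rw [key]
  by_cases hh : h = 0
  · subst hh
    simp
  · simp [hh]

lemma Wc_zero (h : ℤ) (k : ℕ) : Wc 0 h k = if h = 0 ∧ k = 0 then 1 else 0 := by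
  unfold Wc stt
  simp only [range_zero, powerset_empty, sum_singleton, card_empty, filter_empty]
  simp [eq_comm]

lemma Wc_succ (n : ℕ) (h : ℤ) (k : ℕ) :
    Wc (n+1) h k = Wc n h k + Wc n (h-1) k + Wc n (h+1) k +
      (if h = 0 then (if k = 0 then 0 else Wc n h (k-1)) else Wc n h k) := by
  have hn : n ∉ range n := by simp
  have e4 : (if h = 0 then (if k = 0 then 0 else Wc n h (k-1)) else Wc n h k) =
      ∑ R ∈ (range n).powerset, ∑ L ∈ (range n).powerset,
        if ((#R : ℕ) : ℤ) + h = #L ∧ (stt n h R L + if h = 0 then 1 else 0) = k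
          then 1 else 0 := by
    by_cases hh : h = 0
    · rcases k with _ | k
      · simp [hh]
      · simp [hh, Wc]
    · simp [hh, Wc]
  rw [e4]
  conv_lhs => unfold Wc
  rw [range_add_one, sum_powerset_insert hn]
  simp_rw [sum_powerset_insert hn, sum_add_distrib]
  rw [add_assoc (_ + _)]
  unfold Wc
  have c : ∀ R ∈ (range n).powerset, R ⊆ range n ∧ #(insert n R) = #R + 1 := by
    intro R hR
    have hR := mem_powerset.1 hR
    exact ⟨hR, card_insert_of_notMem fun h => hn (hR h)⟩
  congr 1
  · congr 1
    · refine sum_congr rfl fun R hR => sum_congr rfl fun L hL => ?_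
      rw [stt_00 (c R hR).1]
    · refine sum_congr rfl fun R hR => sum_congr rfl fun L hL => ?_
      rw [stt_01 (c R hR).1 (c L hL).1, (c L hL).2]
      congr 2
      push_cast
      apply propext; constructor <;> intro <;> omega
  · congr 1
    · refine sum_congr rfl fun R hR => sum_congr rfl fun L hL => ?_
      rw [stt_10 (c R hR).1 (c L hL).1, (c R hR).2]
      congr 2
      push_cast
      apply propext; constructor <;> intro <;> omega
    · refine sum_congr rfl fun R hR => sum_congr rfl fun L hL => ?_
      rw [stt_11 (c R hR).1 (c L hL).1, (c R hR).2, (c L hL).2]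
      congr 2
      push_cast
      apply propext; constructor <;> intro <;> omega

noncomputable def Fs (h : ℤ) : MvPowerSeries (Fin 2) ℤ := fun d => (Wc (d 1) h (d 0) : ℤ)

noncomputable abbrev zz : MvPowerSeries (Fin 2) ℤ := MvPowerSeries.X 1
noncomputable abbrev ss : MvPowerSeries (Fin 2) ℤ := MvPowerSeries.X 0

lemma coeff_X_mul' (i : Fin 2) (P : MvPowerSeries (Fin 2) ℤ) (d : Fin 2 →₀ ℕ) :
    MvPowerSeries.coeff d (MvPowerSeries.X i * P) =
      if d i = 0 then 0 else MvPowerSeries.coeff (d - Finsupp.single i 1) P := by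
  rw [MvPowerSeries.X, MvPowerSeries.coeff_monomial_mul]
  by_cases h : d i = 0
  · rw [if_neg, if_pos h]
    intro hh
    have := hh i
    simp [h] at this
  · rw [if_pos, if_neg h, one_mul]
    rw [Finsupp.single_le_iff]; omega

lemma coeff_Fs (h : ℤ) (d : Fin 2 →₀ ℕ) :
    MvPowerSeries.coeff d (Fs h) = (Wc (d 1) h (d 0) : ℤ) := rfl

lemma coeff_Cgf (d : Fin 2 →₀ ℕ) :
    MvPowerSeries.coeff d Cgf = if d 0 = 0 then (catalan (d 1) : ℤ) else 0 := rfl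

lemma d_eq_zero_iff (d : Fin 2 →₀ ℕ) : d = 0 ↔ d 0 = 0 ∧ d 1 = 0 := by
  constructor
  · rintro rfl; simp
  · rintro ⟨h0, h1⟩; ext i; fin_cases i <;> simp [h0, h1]

lemma Fs_eq (h : ℤ) : Fs h = (if h = 0 then 1 else 0) +
    zz * (Fs h + Fs (h-1) + Fs (h+1) + (if h = 0 then ss else 1) * Fs h) := by
  classical
  ext d
  rw [map_add, coeff_X_mul']
  by_cases hd : d 1 = 0
  · rw [if_pos hd]
    by_cases hh : h = 0
    · simp [hh, coeff_Fs, MvPowerSeries.coeff_one, hd, Wc_zero, d_eq_zero_iff]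
    · simp [hh, coeff_Fs, hd, Wc_zero]
  · rw [if_neg hd]
    obtain ⟨n, hn⟩ := Nat.exists_eq_succ_of_ne_zero hd
    by_cases hh : h = 0
    · subst hh
      simp only [if_true, map_add, coeff_X_mul', MvPowerSeries.coeff_one, d_eq_zero_iff, hd]
      simp only [coeff_Fs, hn, Nat.succ_eq_add_one, Wc_succ]
      simp [hn]
    · simp only [hh, if_false, map_add, map_zero, one_mul]
      simp only [coeff_Fs, hn, Nat.succ_eq_add_one, Wc_succ]
      simp [hn, hh]

lemma Cgf_eq : Cgf = 1 + zz * (Cgf * Cgf) := by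
  classical
  ext d
  rw [map_add, coeff_X_mul', MvPowerSeries.coeff_one]
  simp only [d_eq_zero_iff]
  by_cases hd : d 1 = 0
  · simp [hd, coeff_Cgf]
  · obtain ⟨n, hn⟩ := Nat.exists_eq_succ_of_ne_zero hd
    simp only [hd, and_false, if_false, zero_add]
    rw [MvPowerSeries.coeff_mul]
    simp only [coeff_Cgf]
    by_cases h0 : d 0 = 0
    · rw [if_pos h0, hn, Nat.succ_eq_add_one, catalan_succ']
      push_cast
      refine Finset.sum_nbij' (fun ij => (Finsupp.single 1 ij.1, Finsupp.single 1 ij.2))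
        (fun ab => (ab.1 1, ab.2 1)) ?_ ?_ ?_ ?_ ?_
      · rintro ⟨i, j⟩ hij
        rw [Finset.HasAntidiagonal.mem_antidiagonal] at hij ⊢
        ext x
        fin_cases x
        · simp [h0]
        · simp [hn]; exact hij
      · rintro ⟨a, b⟩ hab
        rw [Finset.HasAntidiagonal.mem_antidiagonal] at hab ⊢
        have := DFunLike.congr_fun hab 1
        simpa [hn] using this
      · rintro ⟨i, j⟩ hij; simp
      · rintro ⟨a, b⟩ hab
        rw [Finset.HasAntidiagonal.mem_antidiagonal] at hab
        have := DFunLike.congr_fun hab 0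
        simp [h0] at this
        ext x
        · fin_cases x <;> simp [this]
        · fin_cases x <;> simp [this]
      · rintro ⟨i, j⟩ hij; simp
    · rw [if_neg h0]
      symm
      apply Finset.sum_eq_zero
      rintro ⟨a, b⟩ hab
      rw [Finset.HasAntidiagonal.mem_antidiagonal] at hab
      have := DFunLike.congr_fun hab 0
      simp at this
      by_cases ha : a 0 = 0
      · have : b 0 ≠ 0 := by omega
        simp [this]
      · simp [ha]

noncomputable def den : MvPowerSeries (Fin 2) ℤ :=
  (1 - MvPowerSeries.X 0) * MvPowerSeries.X 1 + 1 - 2 * MvPowerSeries.X 1 * Cgf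

lemma exists_inv : ∃ V, V * den = 1 := by
  refine ⟨MvPowerSeries.invOfUnit den 1, ?_⟩
  rw [mul_comm]
  apply MvPowerSeries.mul_invOfUnit
  simp [den]

lemma Fs_zero_mul : Fs 0 * den = 1 := by
  obtain ⟨V, hV⟩ := exists_inv
  set u := Cgf - 1 with hu
  have hu2 : u = zz * (u * u + 2 * u + 1) := by
    have := Cgf_eq
    rw [hu]; linear_combination this
  have hV' : V = 1 + zz * (V + V * u + V * u + ss * V) := by
    have : den = 1 - zz - ss * zz - 2 * zz * u := by rw [hu, den]; ring
    rw [this] at hV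
    linear_combination hV
  have hzu : zz ∣ u := ⟨_, hu2⟩
  let G : ℤ → MvPowerSeries (Fin 2) ℤ := fun h => V * u ^ h.natAbs
  have hG : ∀ h, G h = (if h = 0 then 1 else 0) +
    zz * (G h + G (h-1) + G (h+1) + (if h = 0 then ss else 1) * G h) := by
    intro h
    rcases lt_trichotomy h 0 with hh | hh | hh
    · obtain ⟨m, hm⟩ : ∃ m : ℕ, h = -(m+1 : ℤ) := ⟨(-h-1).toNat, by omega⟩
      have e1 : h.natAbs = m+1 := by omega
      have e2 : (h-1).natAbs = m+2 := by omega
      have e3 : (h+1).natAbs = m := by omega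
      simp only [G, e1, e2, e3, hh.ne, if_false]
      linear_combination V * u^m * hu2
    · subst hh
      simp [G]
      linear_combination hV'
    · obtain ⟨m, hm⟩ : ∃ m : ℕ, h = (m+1 : ℤ) := ⟨(h-1).toNat, by omega⟩
      have e1 : h.natAbs = m+1 := by omega
      have e2 : (h-1).natAbs = m := by omega
      have e3 : (h+1).natAbs = m+2 := by omega
      simp only [G, e1, e2, e3, hh.ne', if_false]
      linear_combination V * u^m * hu2
  have hdvd : ∀ n : ℕ, ∀ h, zz ^ n ∣ Fs h - G h := by
    intro n
    induction n with
    | zero => simp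
    | succ n ih =>
      intro h
      have : Fs h - G h = zz * ((Fs h - G h) + (Fs (h-1) - G (h-1)) + (Fs (h+1) - G (h+1))
        + (if h = 0 then ss else 1) * (Fs h - G h)) := by
        linear_combination Fs_eq h - hG h
      rw [this, pow_succ, mul_comm]
      apply mul_dvd_mul_left
      exact dvd_add (dvd_add (dvd_add (ih _) (ih _)) (ih _)) (Dvd.dvd.mul_left (ih _) _)
  have : Fs 0 = V := by
    have e : Fs 0 - G 0 = 0 := by
      ext d
      exact MvPowerSeries.X_pow_dvd_iff.1 (hdvd (d 1 + 1) 0) d (Nat.lt_succ_self _)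
    have : G 0 = V := by simp [G]
    rw [← this]; exact sub_eq_zero.1 e
  rw [this, hV]

def Rf (n : ℕ) (f : Fin n → ℕ) : Finset ℕ :=
  (range n).filter (fun p => ∃ i : Fin n, f i = i + 1 + p)
def Lf (n : ℕ) (f : Fin n → ℕ) : Finset ℕ :=
  (range n).filter (fun p => ∀ i : Fin n, f i + p ≠ i)

lemma card_down {n : ℕ} (Q : Fin n → Prop) [DecidablePred Q]
    (hQ : ∀ i j, i ≤ j → Q j → Q i) (m : ℕ) (hm : m ≤ n) :
    #(univ.filter Q) = m ↔ ∀ j : Fin n, Q j ↔ j.val < m := by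
  constructor
  · rintro rfl j
    constructor
    · intro hj
      have : Finset.Iic j ⊆ univ.filter Q := by
        intro i hi
        simp only [mem_filter, mem_univ, true_and]
        exact hQ _ _ (Finset.mem_Iic.1 hi) hj
      have := card_le_card this
      rw [Fin.card_Iic] at this
      omega
    · intro hj
      by_contra hn
      have : univ.filter Q ⊆ Finset.Iio j := by
        intro i hi
        simp only [mem_filter, mem_univ, true_and] at hi
        rw [Finset.mem_Iio]
        by_contra h
        exact hn (hQ _ _ (not_lt.1 h) hi)
      have := card_le_card this
      rw [Fin.card_Iio] at this
      omega
  · intro h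
    simp_rw [h]
    rw [Fin.card_filter_val_lt]
    exact min_eq_right hm

variable {n : ℕ} {f : Fin n → ℕ}

lemma card_R (hf : IsBoxPartition n f) (t : ℕ) :
    #((Rf n f).filter (t ≤ ·)) = #(univ.filter fun j : Fin n => j + 1 + t ≤ f j) := by
  symm
  refine Finset.card_bij (fun j _ => f j - j - 1) ?_ ?_ ?_
  · intro j hj
    simp only [mem_filter, mem_univ, true_and, Rf, mem_range] at hj ⊢
    have := hf.2 j
    have := j.2
    exact ⟨⟨by omega, j, by omega⟩, by omega⟩
  · intro i hi j hj hij
    simp only [mem_filter, mem_univ, true_and] at hi hj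
    rcases le_total i j with h | h
    · have := hf.1 h
      have h' : i.val ≤ j.val := h
      ext; omega
    · have := hf.1 h
      have h' : j.val ≤ i.val := h
      ext; omega
  · intro p hp
    simp only [mem_filter, Rf, mem_range] at hp
    obtain ⟨⟨h1, j, hj⟩, h2⟩ := hp
    refine ⟨j, ?_, ?_⟩
    · simp only [mem_filter, mem_univ, true_and]; omega
    · omega

lemma card_L (hf : IsBoxPartition n f) (t : ℕ) (ht : t ≤ n) :
    #((Lf n f).filter (t ≤ ·)) + t = #(univ.filter fun j : Fin n => j < f j + t) := by
  have h1 : #(univ.filter fun j : Fin n => ¬ (j < f j + t)) =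
      #((Finset.Ico t n).filter fun p => ¬ ∀ i : Fin n, f i + p ≠ i) := by
    refine Finset.card_bij (fun j _ => j - f j) ?_ ?_ ?_
    · intro j hj
      simp only [mem_filter, mem_univ, true_and, mem_Ico] at hj ⊢
      have := j.2
      push Not
      exact ⟨by omega, j, by omega⟩
    · intro i hi j hj hij
      simp only [mem_filter, mem_univ, true_and] at hi hj
      rcases le_total i j with h | h
      · have := hf.1 h
        have h' : i.val ≤ j.val := h
        ext; omega
      · have := hf.1 h
        have h' : j.val ≤ i.val := h
        ext; omega
    · intro p hp
      simp only [mem_filter, mem_Ico] at hp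
      push Not at hp
      obtain ⟨h1, j, hj⟩ := hp
      refine ⟨j, ?_, ?_⟩
      · simp only [mem_filter, mem_univ, true_and]; omega
      · omega
  have h2 : (Lf n f).filter (t ≤ ·) =
      (Finset.Ico t n).filter fun p => ∀ i : Fin n, f i + p ≠ i := by
    ext p
    simp only [Lf, mem_filter, mem_range, mem_Ico]
    tauto
  have h3 := Finset.card_filter_add_card_filter_not (s := Finset.Ico t n)
    (fun p => ∀ i : Fin n, f i + p ≠ i)
  have h4 := Finset.card_filter_add_card_filter_not (s := (univ : Finset (Fin n)))
    (fun j : Fin n => j < f j + t)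
  rw [Nat.card_Ico] at h3
  rw [Finset.card_fin] at h4
  rw [h2]
  omega

lemma card_Rf_Lf (hf : IsBoxPartition n f) : #(Rf n f) = #(Lf n f) := by
  have h1 := card_R hf 0
  have h2 := card_L hf 0 (Nat.zero_le _)
  simp only [Nat.zero_le, filter_true, add_zero] at h1 h2
  rw [h1, h2]
  rfl

lemma key_iff (hf : IsBoxPartition n f) (i : Fin n) (p : ℕ) (hp : f i = i + 1 + p) :
    f i = conjAt n f (i + 1) ↔ p ∈ Lf n f ∧ #((Lf n f).filter (p < ·)) = i := by
  have hfi := hf.2 i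
  have hL := card_L hf (p+1) (by omega)
  have e1 : #((Lf n f).filter (p < ·)) = i ↔
      #(univ.filter fun j : Fin n => j < f j + (p+1)) = f i := by
    have : #((Lf n f).filter (p < ·)) = #((Lf n f).filter (p + 1 ≤ ·)) := rfl
    rw [this]; omega
  rw [e1, eq_comm, conjAt]
  rw [card_down (fun j : Fin n => i.val + 1 ≤ f j) (fun a b hab h => le_trans h (hf.1 hab)) _ hfi]
  rw [card_down (fun j : Fin n => j.val < f j + (p+1)) (fun a b hab h => by
    have := hf.1 hab
    have h' : a.val ≤ b.val := hab
    omega) _ hfi]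
  simp only [Lf, mem_filter, mem_range]
  constructor
  · intro h
    refine ⟨⟨by omega, fun j => ?_⟩, fun j => ?_⟩
    · have := h j; omega
    · have := h j; omega
  · rintro ⟨⟨_, h1⟩, h2⟩ j
    constructor
    · intro hj
      by_contra hlt
      have hj2 := j.2
      have a := h2 ⟨f i, by omega⟩
      have b := hf.1 (show (⟨f i, by omega⟩ : Fin n) ≤ j from not_lt.1 hlt)
      simp only [lt_irrefl, iff_false] at a
      omega
    · intro hj
      have a := h2 ⟨f i - 1, by omega⟩
      have c := h1 ⟨f i - 1, by omega⟩
      have b := hf.1 (show j ≤ (⟨f i - 1, by omega⟩ : Fin n) by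
        rw [Fin.le_def]; simp only; omega)
      simp only at a c
      omega

lemma dsh_eq (hf : IsBoxPartition n f) : dshPart n f = stt n 0 (Rf n f) (Lf n f) := by
  have hRi : ∀ (i : Fin n) (p : ℕ), f i = i + 1 + p → #((Rf n f).filter (p < ·)) = i := by
    intro i p hp
    have : #((Rf n f).filter (p < ·)) = #((Rf n f).filter (p + 1 ≤ ·)) := rfl
    rw [this, card_R hf (p+1), card_down (fun j : Fin n => j.val + 1 + (p+1) ≤ f j)
      (fun a b hab h => by
        have := hf.1 hab
        have h' : a.val ≤ b.val := hab
        omega) _ i.2.le]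
    intro j
    rcases lt_or_ge j i with h | h
    · have := hf.1 h.le
      have h' : j.val < i.val := h
      omega
    · have := hf.1 h
      have h' : i.val ≤ j.val := h
      omega
  unfold dshPart stt
  refine Finset.card_bij (fun j _ => f j - j - 1) ?_ ?_ ?_
  · intro i hi
    simp only [mem_filter, mem_univ, true_and] at hi
    have hfi := hf.2 i
    have hp : f i = i + 1 + (f i - i - 1) := by omega
    have k := (key_iff hf i _ hp).1 hi.2
    simp only [mem_filter, mem_range]
    refine ⟨by omega, ?_, k.1, ?_⟩
    · simp only [Rf, mem_filter, mem_range]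
      exact ⟨by omega, i, hp⟩
    · rw [hRi i _ hp, k.2, add_zero]
  · intro i hi j hj hij
    simp only [mem_filter, mem_univ, true_and] at hi hj
    rcases le_total i j with h | h
    · have := hf.1 h
      have h' : i.val ≤ j.val := h
      ext; omega
    · have := hf.1 h
      have h' : j.val ≤ i.val := h
      ext; omega
  · intro p hp
    simp only [mem_filter, mem_range] at hp
    obtain ⟨hpn, hR, hL, he⟩ := hp
    obtain ⟨i, hi⟩ := (mem_filter.1 hR).2
    refine ⟨i, ?_, by omega⟩
    simp only [mem_filter, mem_univ, true_and]
    refine ⟨by omega, (key_iff hf i p hi).2 ⟨hL, ?_⟩⟩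
    rw [hRi i p hi] at he
    omega

lemma mem_range_iff (hf : IsBoxPartition n f) (x : ℕ) :
    x ∈ Set.range (fun i : Fin n => f i.rev + i) ↔
      (n ≤ x ∧ x - n ∈ Rf n f) ∨ (x < n ∧ n - 1 - x ∉ Lf n f) := by
  simp only [Rf, Lf, mem_filter, mem_range, Set.mem_range]
  constructor
  · rintro ⟨i, rfl⟩
    have h1 := hf.2 i.rev
    have h2 := i.2
    have h3 : (i.rev : ℕ) = n - (i + 1) := Fin.val_rev i
    rcases le_or_gt n (f i.rev + i) with h | h
    · left
      exact ⟨h, by omega, i.rev, by omega⟩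
    · right
      refine ⟨h, ?_⟩
      rintro ⟨_, h'⟩
      have := h' i.rev
      omega
  · rintro (⟨h, h1, j, hj⟩ | ⟨h, h1⟩)
    · refine ⟨j.rev, ?_⟩
      have h2 := j.2
      have h3 : (j.rev : ℕ) = n - (j + 1) := Fin.val_rev j
      rw [Fin.rev_rev]
      omega
    · have : ∃ j : Fin n, f j + (n-1-x) = j := by
        by_contra hc
        push Not at hc
        exact h1 ⟨by omega, hc⟩
      obtain ⟨j, hj⟩ := this
      refine ⟨j.rev, ?_⟩
      have h2 := j.2
      have h3 : (j.rev : ℕ) = n - (j + 1) := Fin.val_rev j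
      rw [Fin.rev_rev]
      omega

lemma strictMono_aux (hf : IsBoxPartition n f) :
    StrictMono (fun i : Fin n => f i.rev + i) := by
  intro i j hij
  have := hf.1 (Fin.rev_le_rev.2 hij.le)
  have h' : i.val < j.val := hij
  simp only
  omega

lemma RL_inj {g : Fin n → ℕ} (hf : IsBoxPartition n f) (hg : IsBoxPartition n g)
    (hR : Rf n f = Rf n g) (hL : Lf n f = Lf n g) : f = g := by
  have : Set.range (fun i : Fin n => f i.rev + i) = Set.range (fun i : Fin n => g i.rev + i) := by
    ext x
    rw [mem_range_iff hf, mem_range_iff hg, hR, hL]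
  rw [(strictMono_aux hf).range_inj (strictMono_aux hg)] at this
  funext i
  have := congrFun this i.rev
  simpa using this

lemma strict_gap {e : Fin n → ℕ} (he : StrictMono e) :
    ∀ (k : ℕ) (i j : Fin n), j.val = i.val + k → e i + k ≤ e j := by
  intro k
  induction k with
  | zero => intro i j h; have : i = j := by ext; omega
            subst this; simp
  | succ k ih =>
    intro i j h
    have hj := j.2
    have := ih i ⟨i + k, by omega⟩ rfl
    have h2 : e ⟨i + k, by omega⟩ < e j := he (by rw [Fin.lt_def]; simp only; omega)
    omega

lemma RL_surj {R L : Finset ℕ} (hR : R ⊆ range n) (hL : L ⊆ range n) (hc : #R = #L) :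
    ∃ f, IsBoxPartition n f ∧ Rf n f = R ∧ Lf n f = L := by
  set S : Finset ℕ := R.image (n + ·) ∪ (range n \ L).image (n - 1 - ·) with hS
  have hmem : ∀ x, x ∈ S ↔ (n ≤ x ∧ x - n ∈ R) ∨ (x < n ∧ n - 1 - x ∉ L) := by
    intro x
    simp only [hS, mem_union, mem_image, mem_sdiff, mem_range]
    constructor
    · rintro (⟨a, ha, rfl⟩ | ⟨a, ⟨ha, ha'⟩, rfl⟩)
      · left; exact ⟨by omega, by simpa using ha⟩
      · right; refine ⟨by omega, ?_⟩
        have : n - 1 - (n - 1 - a) = a := by omega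
        rwa [this]
    · rintro (⟨h, h'⟩ | ⟨h, h'⟩)
      · left; exact ⟨_, h', by omega⟩
      · right; exact ⟨_, ⟨by omega, h'⟩, by omega⟩
  have hcard : #S = n := by
    rw [hS, card_union_of_disjoint, card_image_of_injective, card_image_of_injOn,
      card_sdiff_of_subset hL, card_range, hc]
    · have := card_le_card hL
      rw [card_range] at this
      omega
    · intro a ha b hb hab
      simp only [coe_sdiff, coe_range, Set.mem_sdiff, Set.mem_Iio] at ha hb hab
      omega
    · intro a b hab
      simpa using hab
    · rw [disjoint_left]
      intro x hx hx'
      simp only [mem_image, mem_sdiff, mem_range] at hx hx'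
      obtain ⟨a, _, rfl⟩ := hx
      obtain ⟨b, hb, hb'⟩ := hx'
      omega
  set e := S.orderEmbOfFin hcard with he
  have hmono : StrictMono e := e.strictMono
  have hlt : ∀ i, e i < 2 * n := by
    intro i
    have h1 : e i ∈ S := Finset.orderEmbOfFin_mem S hcard i
    rcases (hmem _).1 h1 with ⟨h, h'⟩ | ⟨h, h'⟩
    · have := mem_range.1 (hR h'); omega
    · omega
  have hge : ∀ i : Fin n, i.val ≤ e i := by
    intro i
    have := strict_gap hmono i.val ⟨0, i.pos⟩ i (by simp)
    omega
  have hfe : ∀ i : Fin n, (e i.rev.rev - i.rev.rev.val) + i.val = e i := by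
    intro i
    rw [Fin.rev_rev]
    have := hge i
    omega
  refine ⟨fun j => e j.rev - j.rev.val, ?_⟩
  have hbox : IsBoxPartition n (fun j => e j.rev - j.rev.val) := by
    constructor
    · intro i j hij
      have h' : i.val ≤ j.val := hij
      have hi := i.2
      have hj := j.2
      have h3 : (j.rev : ℕ) = n - (j + 1) := Fin.val_rev j
      have h4 : (i.rev : ℕ) = n - (i + 1) := Fin.val_rev i
      have := strict_gap hmono (j - i) j.rev i.rev (by omega)
      simp only
      omega
    · intro i
      have hi := i.2
      have h4 : (i.rev : ℕ) = n - (i + 1) := Fin.val_rev i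
      have := strict_gap hmono i.val i.rev ⟨n-1, by omega⟩ (by simp only; omega)
      have := hlt ⟨n-1, by omega⟩
      simp only
      omega
  have hrange : ∀ x, x ∈ S ↔ (n ≤ x ∧ x - n ∈ Rf n (fun j => e j.rev - j.rev.val)) ∨
      (x < n ∧ n - 1 - x ∉ Lf n (fun j => e j.rev - j.rev.val)) := by
    intro x
    rw [← mem_range_iff hbox]
    simp only [hfe]
    have := Finset.range_orderEmbOfFin S hcard
    rw [← he] at this
    change x ∈ S ↔ x ∈ Set.range e
    rw [this]; simp
  refine ⟨hbox, ?_, ?_⟩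
  · ext p
    have h1 := hrange (n + p)
    rw [hmem] at h1
    simpa using h1.symm
  · ext p
    by_cases hp : p < n
    · have h1 := hrange (n - 1 - p)
      rw [hmem] at h1
      have h2 : n - 1 - (n - 1 - p) = p := by omega
      have h3 : ¬ n ≤ n - 1 - p := by omega
      have h4 : n - 1 - p < n := by omega
      rw [h2] at h1
      simp only [h3, h4, false_and, true_and, false_or] at h1
      exact (not_iff_not.1 h1).symm
    · constructor
      · intro h; exact absurd (mem_range.1 (mem_filter.1 h).1) hp
      · intro h; exact absurd (mem_range.1 (hL h)) hp

lemma ncard_eq_Wc (n k : ℕ) :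
    {f : Fin n → ℕ | IsBoxPartition n f ∧ dshPart n f = k}.ncard = Wc n 0 k := by
  have : Wc n 0 k = #(((range n).powerset ×ˢ (range n).powerset).filter
      fun x => ((#x.1 : ℕ) : ℤ) + 0 = #x.2 ∧ stt n 0 x.1 x.2 = k) := by
    rw [card_filter, sum_product]
    rfl
  rw [this, ← Set.ncard_coe_finset]
  refine Set.ncard_congr (fun f _ => (Rf n f, Lf n f)) ?_ ?_ ?_
  · rintro f ⟨hf, hk⟩
    simp only [coe_filter, mem_product, mem_powerset, Set.mem_ofPred_eq]
    refine ⟨⟨filter_subset _ _, filter_subset _ _⟩, ?_, ?_⟩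
    · rw [card_Rf_Lf hf, add_zero]
    · rw [← dsh_eq hf, hk]
  · rintro f g ⟨hf, _⟩ ⟨hg, _⟩ h
    rw [Prod.mk.injEq] at h
    exact RL_inj hf hg h.1 h.2
  · rintro ⟨R, L⟩ h
    simp only [coe_filter, mem_product, mem_powerset, Set.mem_ofPred_eq] at h
    obtain ⟨⟨hR, hL⟩, hc, hs⟩ := h
    obtain ⟨f, hf, h1, h2⟩ := RL_surj hR hL (by omega)
    exact ⟨f, ⟨hf, by rw [dsh_eq hf, h1, h2, hs]⟩, by rw [h1, h2]⟩

lemma A_eq : A = Fs 0 := by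
  funext d
  simp only [A, Fs, ncard_eq_Wc]

lemma box_finite (n : ℕ) : {f : Fin n → ℕ | IsBoxPartition n f}.Finite := by
  apply (Set.Finite.pi' (fun _ : Fin n => Set.finite_Iic n)).subset
  intro f hf i
  exact hf.2 i

lemma B_count_zero (k : ℕ) : {f : Fin 0 → ℕ | IsBoxPartition 0 f ∧
      max (Finset.univ.sup f) (conjAt 0 f 1) = 0 ∧ dshPart 0 f = k} =
    {f : Fin 0 → ℕ | IsBoxPartition 0 f ∧ dshPart 0 f = k} := by
  ext f
  simp [conjAt]

lemma box_small_iff {m : ℕ} {f : Fin (m+1) → ℕ} (hf : IsBoxPartition (m+1) f) :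
    max (Finset.univ.sup f) (conjAt (m+1) f 1) ≠ m + 1 ↔
      (∀ i, f i ≤ m) ∧ f (Fin.last m) = 0 := by
  have h1 : Finset.univ.sup f ≤ m + 1 := Finset.sup_le fun i _ => hf.2 i
  have h2 : conjAt (m+1) f 1 ≤ m + 1 := by
    unfold conjAt
    exact (card_filter_le _ _).trans (by simp)
  have h3 : conjAt (m+1) f 1 = m + 1 ↔ 1 ≤ f (Fin.last m) := by
    unfold conjAt
    rw [card_down (fun j : Fin (m+1) => 1 ≤ f j) (fun a b hab h => le_trans h (hf.1 hab)) _ le_rfl]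
    constructor
    · intro h; exact (h (Fin.last m)).2 (by simp)
    · intro h j
      exact ⟨fun _ => j.2, fun _ => h.trans (hf.1 (Fin.le_last j))⟩
  have h4 : Finset.univ.sup f ≤ m ↔ ∀ i, f i ≤ m := by simp
  rw [← h4]
  omega

lemma conjAt_snoc {m : ℕ} (f : Fin m → ℕ) (i : ℕ) :
    conjAt (m+1) (Fin.snoc (α := fun _ => ℕ) f 0) (i+1) = conjAt m f (i+1) := by
  unfold conjAt
  rw [card_filter, card_filter, Fin.sum_univ_castSucc]
  simp

lemma dsh_snoc {m : ℕ} (f : Fin m → ℕ) :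
    dshPart (m+1) (Fin.snoc (α := fun _ => ℕ) f 0) = dshPart m f := by
  unfold dshPart
  simp only [conjAt_snoc]
  rw [card_filter, card_filter, Fin.sum_univ_castSucc]
  simp

lemma box_snoc {m : ℕ} {f : Fin m → ℕ} (hf : IsBoxPartition m f) :
    IsBoxPartition (m+1) (Fin.snoc (α := fun _ => ℕ) f 0) := by
  constructor
  · intro i j hij
    induction j using Fin.lastCases with
    | last => simp
    | cast j =>
      induction i using Fin.lastCases with
      | last =>
        have h' : m ≤ j.val := hij
        have := j.2
        omega
      | cast i =>
        simp only [Fin.snoc_castSucc]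
        exact hf.1 hij
  · intro i
    induction i using Fin.lastCases with
    | last => simp
    | cast i =>
      simp only [Fin.snoc_castSucc]
      exact (hf.2 i).trans (Nat.le_succ m)

lemma B_count_succ (m k : ℕ) :
    {f : Fin (m+1) → ℕ | IsBoxPartition (m+1) f ∧ dshPart (m+1) f = k}.ncard =
    {f : Fin (m+1) → ℕ | IsBoxPartition (m+1) f ∧
      max (Finset.univ.sup f) (conjAt (m+1) f 1) = m+1 ∧ dshPart (m+1) f = k}.ncard +
    {f : Fin m → ℕ | IsBoxPartition m f ∧ dshPart m f = k}.ncard := by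
  have h1 : {f : Fin m → ℕ | IsBoxPartition m f ∧ dshPart m f = k}.ncard =
      {f : Fin (m+1) → ℕ | IsBoxPartition (m+1) f ∧
      max (Finset.univ.sup f) (conjAt (m+1) f 1) ≠ m+1 ∧ dshPart (m+1) f = k}.ncard := by
    refine Set.ncard_congr (fun f _ => Fin.snoc (α := fun _ => ℕ) f 0) ?_ ?_ ?_
    · rintro f ⟨hf, hk⟩
      refine ⟨box_snoc hf, (box_small_iff (box_snoc hf)).2 ⟨?_, by simp⟩, by rw [dsh_snoc, hk]⟩
      intro i
      induction i using Fin.lastCases with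
      | last => simp
      | cast i =>
        simp only [Fin.snoc_castSucc]
        exact hf.2 i
    · rintro f g _ _ h
      funext i
      have := congrFun h i.castSucc
      simpa using this
    · rintro f ⟨hf, hs, hk⟩
      obtain ⟨h1, h2⟩ := (box_small_iff hf).1 hs
      have e : Fin.snoc (α := fun _ => ℕ) (fun i : Fin m => f i.castSucc) 0 = f := by
        funext i
        induction i using Fin.lastCases with
        | last => simp [h2]
        | cast i => simp
      refine ⟨fun i => f i.castSucc, ⟨⟨?_, fun i => h1 _⟩, ?_⟩, e⟩
      · intro i j hij; exact hf.1 (Fin.castSucc_le_castSucc_iff.2 hij)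
      · rw [← dsh_snoc, e, hk]
  rw [h1, ← Set.ncard_union_eq _ ((box_finite _).subset fun f hf => hf.1)
    ((box_finite _).subset fun f hf => hf.1)]
  · congr 1
    ext f
    simp only [Set.mem_union, Set.mem_ofPred_eq]
    tauto
  · rw [Set.disjoint_left]
    rintro f ⟨_, h, _⟩ ⟨_, h', _⟩
    exact h' h

lemma coeff_A (d : Fin 2 →₀ ℕ) : MvPowerSeries.coeff d A =
  ({f : Fin (d 1) → ℕ | IsBoxPartition (d 1) f ∧ dshPart (d 1) f = d 0}.ncard : ℤ) := rfl

lemma coeff_B (d : Fin 2 →₀ ℕ) : MvPowerSeries.coeff d B =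
  ({f : Fin (d 1) → ℕ | IsBoxPartition (d 1) f ∧
      max (Finset.univ.sup f) (conjAt (d 1) f 1) = d 1 ∧ dshPart (d 1) f = d 0}.ncard : ℤ) := rfl

lemma B_eq : A = B + zz * A := by
  ext d
  rw [map_add, coeff_X_mul', coeff_A, coeff_B, coeff_A]
  have e0 : (d - (Finsupp.single 1 1 : Fin 2 →₀ ℕ)) 0 = d 0 := by simp
  have e1 : (d - (Finsupp.single 1 1 : Fin 2 →₀ ℕ)) 1 = d 1 - 1 := by simp
  rw [e0, e1]
  generalize d 1 = n
  generalize d 0 = k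
  rcases n with _ | m
  · rw [B_count_zero]; simp
  · simp only [Nat.succ_ne_zero, if_false, Nat.add_sub_cancel]
    exact_mod_cast B_count_succ m k


end

/-- `A·((1−s)z + 1 − 2zC(z)) = 1` and `B·((1−s)z + 1 − 2zC(z)) = 1 − z` in `ℤ[[s,z]]`,
i.e. `A = 1/((1−s)z + √(1−4z))` and `B = (1−z)/((1−s)z + √(1−4z))`. -/
theorem partition_dsh_gf :
    A * ((1 - MvPowerSeries.X 0) * MvPowerSeries.X 1
        + 1 - 2 * MvPowerSeries.X 1 * Cgf) = 1 ∧
    B * ((1 - MvPowerSeries.X 0) * MvPowerSeries.X 1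
        + 1 - 2 * MvPowerSeries.X 1 * Cgf) = 1 - MvPowerSeries.X 1 := by
  have hA : A * den = 1 := by rw [A_eq, Fs_zero_mul]
  refine ⟨hA, ?_⟩
  change B * den = 1 - zz
  linear_combination (1 - zz) * hA - den * B_eq
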